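/- arXiv:2601.17685 — 4 statements merged into one kernel-verified Lean document; each statement's English description precedes it below -/
import Mathlib

section
/- Let δ > 0 and let F be an entire function whose zero set Γ = {λ_j}_{j∈ℤ} consists of simple real zeros with separation inf_{i≠j} |λ_i − λ_j| ≥ λ > 0, such that (i) there is a constant C₁ > 0 with |F(z)| ≤ C₁ e^{δ|Im z|} for all z ∈ ℂ, and (ii) for every η > 0 there is c_η > 0 with |F(z)| ≥ c_η e^{δ|Im z|} whenever inf_j |z − λ_j| ≥ η. Then there exists a constant C (depending on F and Γ) such that for every x ∈ ℝ, Σ_{j∈ℤ} | F(x) / ( F′(λ_j) (x − λ_j) ) |² ≤ C (terms with x = λ_j interpreted as the limit value 1). -/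
lemma aux_G (F : ℂ → ℂ) (hF : Differentiable ℂ F) (a : ℂ) (ha : F a = 0) (r : ℝ) (hr : 0 < r)
    (hd : deriv F a ≠ 0) (hz : ∀ z, ‖z - a‖ ≤ r → F z = 0 → z = a)
    (c M : ℝ) (hc : 0 < c) (hlo : ∀ z, ‖z - a‖ = r → c ≤ ‖F z‖)
    (hup : ∀ z, ‖z - a‖ = r → ‖F z‖ ≤ M) :
    c / r ≤ ‖deriv F a‖ ∧ ∀ z, ‖z - a‖ ≤ r → z ≠ a → ‖F z‖ ≤ M / r * ‖z - a‖ := by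
  have hG : Differentiable ℂ (dslope F a) := by
    rw [← differentiableOn_univ]
    exact (Complex.differentiableOn_dslope Filter.univ_mem).2 hF.differentiableOn
  have hGz : ∀ z, z ≠ a → ‖dslope F a z‖ = ‖F z‖ / ‖z - a‖ := by
    intro z hza
    rw [dslope_of_ne _ hza, slope_def_field, ha, sub_zero, norm_div]
  have hGa : dslope F a a = deriv F a := dslope_same F a
  have hcl : closure (Metric.ball a r) = Metric.closedBall a r := closure_ball a hr.ne'
  have hfr : ∀ z ∈ frontier (Metric.ball a r), ‖z - a‖ = r := by
    intro z h
    rw [frontier_ball a hr.ne', mem_sphere_iff_norm] at h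
    exact h
  have hne : ∀ z, ‖z - a‖ = r → z ≠ a := by
    rintro z h rfl
    simp at h; linarith
  constructor
  · have hnz : ∀ z ∈ closure (Metric.ball a r), dslope F a z ≠ 0 := by
      intro z h
      rw [hcl, mem_closedBall_iff_norm] at h
      by_cases hza : z = a
      · rw [hza, hGa]; exact hd
      · intro h0
        have h1 := hGz z hza
        rw [h0, norm_zero] at h1
        have h2 : ‖z - a‖ ≠ 0 := by simpa [sub_eq_zero] using hza
        have h3 : ‖F z‖ = 0 := by
          field_simp at h1
          linarith
        exact hza (hz z h (norm_eq_zero.1 h3))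
    have hinv : DiffContOnCl ℂ (fun z => (dslope F a z)⁻¹) (Metric.ball a r) :=
      (hG.diffContOnCl).inv hnz
    have := Complex.norm_le_of_forall_mem_frontier_norm_le (Metric.isBounded_ball) hinv
      (C := r / c) (fun z h => by
        have h1 := hfr z h
        rw [norm_inv, hGz z (hne z h1), h1, inv_div]
        exact div_le_div_of_nonneg_left hr.le hc (hlo z h1))
      (subset_closure (Metric.mem_ball_self hr))
    simp only [hGa, norm_inv] at this
    have h4 : 0 < ‖deriv F a‖ := norm_pos_iff.2 hd
    rw [← inv_div]
    exact inv_le_of_inv_le₀ h4 this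
  · intro z h hza
    have := Complex.norm_le_of_forall_mem_frontier_norm_le (Metric.isBounded_ball)
      (hG.diffContOnCl (s := Metric.ball a r))
      (C := M / r) (fun z h => by
        have h1 := hfr z h
        rw [hGz z (hne z h1), h1]
        exact div_le_div_of_nonneg_right (hup z h1) hr.le)
      (z := z) (by rw [hcl, mem_closedBall_iff_norm]; exact h)
    rw [hGz z hza] at this
    have h2 : 0 < ‖z - a‖ := by simpa [sub_eq_zero] using hza
    exact (div_le_iff₀ h2).1 this


/-- Sine-type function square-sum bound for the Lagrange kernel:
for a sine-type function `F` of bandwidth `δ` with real separated simple zeros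
`Λ j`, the sums `Σ_j |F(x)/(F'(λ_j)(x-λ_j))|²` are uniformly bounded in `x ∈ ℝ`
(terms with `x = λ_j` interpreted as the limit value `1`). -/
theorem stmt3
    (δ : ℝ) (hδ : 0 < δ)
    (F : ℂ → ℂ) (hF : Differentiable ℂ F)
    (Λ : ℤ → ℝ) (lam : ℝ) (hlam : 0 < lam)
    (hsep : ∀ i j : ℤ, i ≠ j → lam ≤ |Λ i - Λ j|)
    (hzero : ∀ j : ℤ, F (Λ j) = 0)
    (hsimple : ∀ j : ℤ, deriv F (Λ j) ≠ 0)
    (hzset : ∀ z : ℂ, F z = 0 → ∃ j : ℤ, z = (Λ j : ℂ))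
    (C₁ : ℝ) (hC₁ : 0 < C₁)
    (hupper : ∀ z : ℂ, ‖F z‖ ≤ C₁ * Real.exp (δ * |z.im|))
    (hlower : ∀ η : ℝ, 0 < η → ∃ c : ℝ, 0 < c ∧ ∀ z : ℂ,
      (∀ j : ℤ, η ≤ ‖z - (Λ j : ℂ)‖) →
      c * Real.exp (δ * |z.im|) ≤ ‖F z‖) :
    ∃ C : ℝ, ∀ x : ℝ, ∀ s : Finset ℤ,
      ∑ j ∈ s, (if x = Λ j then (1 : ℝ)
        else (‖F x / (deriv F (Λ j) * ((x : ℂ) - (Λ j : ℂ)))‖) ^ 2) ≤ C := by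
  obtain ⟨c, hc, hlow⟩ := hlower (lam / 2) (by positivity)
  set r := lam / 2 with hrdef
  have hr : 0 < r := by positivity
  have hre : ∀ a b : ℝ, ‖(a : ℂ) - (b : ℂ)‖ = |a - b| := by
    intro a b
    rw [← Complex.ofReal_sub, Complex.norm_real, Real.norm_eq_abs]
  set M := C₁ * Real.exp (δ * r) with hM
  have hMC : C₁ ≤ M := by
    have : 1 ≤ Real.exp (δ * r) := Real.one_le_exp (by positivity)
    rw [hM]; nlinarith
  have key : ∀ j, c / r ≤ ‖deriv F (Λ j)‖ ∧
      ∀ z, ‖z - (Λ j : ℂ)‖ ≤ r → z ≠ (Λ j : ℂ) → ‖F z‖ ≤ M / r * ‖z - (Λ j : ℂ)‖ := by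
    intro j
    refine aux_G F hF (Λ j) (hzero j) r hr (hsimple j) ?_ c M hc ?_ ?_
    · intro z h h0
      obtain ⟨i, rfl⟩ := hzset z h0
      by_contra hne
      have hij : i ≠ j := by rintro rfl; exact hne rfl
      have := hsep i j hij
      rw [hre] at h
      linarith
    · intro z h
      have h1 := hlow z (by
        intro i
        by_cases hij : i = j
        · rw [hij, h]
        · have h2 := hsep i j hij
          rw [← hre] at h2
          have h3 := norm_sub_le_norm_sub_add_norm_sub (Λ i : ℂ) z (Λ j)
          rw [norm_sub_rev (Λ i : ℂ) z] at h3
          linarith)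
      have h2 : 1 ≤ Real.exp (δ * |z.im|) := Real.one_le_exp (by positivity)
      nlinarith
    · intro z h
      refine (hupper z).trans ?_
      have h1 : |z.im| ≤ r := by
        have := Complex.abs_im_le_norm (z - Λ j)
        simpa [h] using this
      rw [hM]
      gcongr
  have hFx : ∀ x : ℝ, ‖F x‖ ≤ C₁ := by
    intro x
    simpa using hupper x
  set m := c / r with hm
  have hmpos : 0 < m := by positivity
  have hMpos : 0 < M := by positivity
  set A := (M / r / m) ^ 2 + 1 with hA
  set B := (C₁ / (m * lam)) ^ 2 with hB
  have hsum : Summable fun n : ℤ => 1 / |(n : ℝ) + 1 / 2| ^ (2 : ℝ) :=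
    (Real.summable_one_div_int_add_rpow (1 / 2) 2).2 (by norm_num)
  refine ⟨(A / 2 + 2 * B) * ∑' n : ℤ, 1 / |(n : ℝ) + 1 / 2| ^ (2 : ℝ), fun x s => ?_⟩
  set N : ℤ → ℤ := fun j => ⌊(Λ j - x) / lam⌋ with hN
  have hinj : Function.Injective N := by
    intro i j hij
    by_contra hne
    have h1 := hsep i j hne
    have h2 := Int.abs_sub_lt_one_of_floor_eq_floor hij
    rw [← sub_div, abs_div, abs_of_pos hlam, div_lt_one hlam] at h2
    have h3 : Λ i - x - (Λ j - x) = Λ i - Λ j := by ring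
    rw [h3] at h2
    linarith
  have hterm : ∀ j, (if x = Λ j then (1 : ℝ)
        else (‖F x / (deriv F (Λ j) * ((x : ℂ) - (Λ j : ℂ)))‖) ^ 2) ≤
        (A / 2 + 2 * B) * (1 / |(N j : ℝ) + 1 / 2| ^ (2 : ℝ)) := by
    intro j
    set T := (if x = Λ j then (1 : ℝ)
        else (‖F x / (deriv F (Λ j) * ((x : ℂ) - (Λ j : ℂ)))‖) ^ 2) with hT
    set u := (Λ j - x) / lam with hu
    have hT0 : 0 ≤ T := by rw [hT]; split_ifs <;> positivity
    have hTB : T ≤ A ∧ T * u ^ 2 ≤ B := by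
      by_cases hx : x = Λ j
      · have : u = 0 := by rw [hu, hx]; simp
        rw [this, hT, if_pos hx]
        constructor
        · rw [hA]; nlinarith [sq_nonneg (M / r / m)]
        · rw [hB]; simp; positivity
      · rw [hT, if_neg hx]
        have hd : 0 < |x - Λ j| := abs_pos.2 (sub_ne_zero.2 hx)
        obtain ⟨k1, k2⟩ := key j
        rw [norm_div, norm_mul, hre]
        have hD : 0 < ‖deriv F (Λ j)‖ := hmpos.trans_le k1
        constructor
        · have h1 : ‖F x‖ ≤ M / r * |x - Λ j| := by
            by_cases hle : |x - Λ j| ≤ r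
            · have := k2 x (by rw [hre]; exact hle) (by exact_mod_cast hx)
              rwa [hre] at this
            · push Not at hle
              calc ‖F x‖ ≤ M := (hFx x).trans hMC
                _ = M / r * r := by field_simp
                _ ≤ _ := by gcongr
          have h2 : ‖F x‖ / (‖deriv F (Λ j)‖ * |x - Λ j|) ≤ M / r / m := by
            rw [div_le_div_iff₀ (by positivity) hmpos]
            calc ‖F x‖ * m ≤ (M / r * |x - Λ j|) * ‖deriv F (Λ j)‖ := by gcongr
              _ = _ := by ring
          have h3 := pow_le_pow_left₀ (by positivity) h2 2
          rw [hA]; linarith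
        · have h0 : u ^ 2 = (|x - Λ j| / lam) ^ 2 := by
            rw [hu, div_pow, div_pow, sq_abs]; ring
          rw [h0, ← mul_pow, hB]
          apply pow_le_pow_left₀ (by positivity)
          have : ‖F x‖ / (‖deriv F (Λ j)‖ * |x - Λ j|) * (|x - Λ j| / lam)
            = ‖F x‖ / (‖deriv F (Λ j)‖ * lam) := by field_simp
          rw [this]
          have := hFx x
          gcongr
    obtain ⟨hTA, hTB⟩ := hTB
    have f1 : (N j : ℝ) ≤ u := Int.floor_le u
    have f2 : u < (N j : ℝ) + 1 := Int.lt_floor_add_one u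
    have hpos : 0 < |(N j : ℝ) + 1 / 2| := by
      apply abs_pos.2
      intro h
      have h2 : ((2 * N j + 1 : ℤ) : ℝ) = 0 := by push_cast; linarith
      have h3 : 2 * N j + 1 = 0 := by exact_mod_cast h2
      omega
    have hp : |(N j : ℝ) + 1 / 2| ^ (2 : ℝ) = ((N j : ℝ) + 1 / 2) ^ 2 := by
      rw [Real.rpow_two, sq_abs]
    have hpp : 0 < |(N j : ℝ) + 1 / 2| ^ (2 : ℝ) := by positivity
    rw [mul_one_div, le_div_iff₀ hpp, hp]
    have hq : ((N j : ℝ) + 1 / 2) ^ 2 ≤ 2 * u ^ 2 + 1 / 2 := by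
      have g : ((N j : ℝ) + 1 / 2 - u) ^ 2 ≤ (1 / 2) ^ 2 := by
        apply sq_le_sq'  <;> linarith
      nlinarith [sq_nonneg ((N j : ℝ) + 1 / 2 - 2 * u)]
    nlinarith [mul_le_mul_of_nonneg_left hq hT0]
  calc _ ≤ ∑ j ∈ s, (A / 2 + 2 * B) * (1 / |(N j : ℝ) + 1 / 2| ^ (2 : ℝ)) :=
        Finset.sum_le_sum fun j _ => hterm j
    _ = (A / 2 + 2 * B) * ∑ j ∈ s, (1 / |(N j : ℝ) + 1 / 2| ^ (2 : ℝ)) := by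
        rw [Finset.mul_sum]
    _ ≤ _ := by
        apply mul_le_mul_of_nonneg_left _ (by positivity)
        refine (Finset.sum_map s ⟨N, hinj⟩ (fun n : ℤ => 1 / |(n : ℝ) + 1 / 2| ^ (2 : ℝ))).symm.trans_le ?_
        exact hsum.sum_le_tsum _ (fun n _ => by positivity)
end

section
/- Let N be a positive integer, 0 ≤ L < 1, and let Λ = {λ_j}_{j=−N}^{N} ⊂ ℝ satisfy inf_{−N ≤ j < k ≤ N} |λ_j − λ_k| > 0 and sup_{|j| ≤ N} |λ_j − j| = L. Set λ̄_j = λ_j for |j| ≤ N and λ̄_j = j for |j| > N. Then there exists an entire function F_Λ with F_Λ(z) = sin(πz) ∏_{j=−N}^{N} (z − λ_j)/(z − j) for all z ∉ {−N, …, N}, and F_Λ is a sine-type function with bandwidth π: (i) its zero set is {λ̄_j}_{j∈ℤ}, which is real and uniformly separated; (ii) there is a constant C > 0 with |F_Λ(z)| ≤ C e^{π|Im z|} for all z ∈ ℂ; (iii) for every η ∈ (0, 1) there is a constant c_η > 0 such that |F_Λ(z)| ≥ c_η e^{π|Im z|} whenever inf_{j∈ℤ} |z − λ̄_j| ≥ η.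 -/
/-- The extended node sequence: `λ̄_j = λ_j` for `|j| ≤ N` and `λ̄_j = j` for `|j| > N`. -/
noncomputable def lambdaBar (N : ℕ) (Λ : ℤ → ℝ) (j : ℤ) : ℝ :=
  if |j| ≤ (N : ℤ) then Λ j else (j : ℝ)

lemma sin_norm_le (w : ℂ) : ‖Complex.sin w‖ ≤ Real.exp |w.im| := by
  have h1 : ‖Complex.exp (-w * Complex.I)‖ ≤ Real.exp |w.im| := by
    rw [Complex.norm_exp]; apply Real.exp_le_exp.2
    simp; exact le_abs_self _
  have h2 : ‖Complex.exp (w * Complex.I)‖ ≤ Real.exp |w.im| := by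
    rw [Complex.norm_exp]; apply Real.exp_le_exp.2
    simp; exact neg_le_abs _
  rw [Complex.sin]
  have h3 := norm_sub_le (Complex.exp (-w * Complex.I)) (Complex.exp (w * Complex.I))
  simp only [norm_div, norm_mul, Complex.norm_I, Complex.norm_ofNat]
  linarith

lemma sin_norm_ge (w : ℂ) (hw : 1 ≤ |w.im|) : Real.exp |w.im| / 4 ≤ ‖Complex.sin w‖ := by
  have h1 : ‖Complex.exp (-w * Complex.I)‖ = Real.exp w.im := by
    rw [Complex.norm_exp]; simp
  have h2 : ‖Complex.exp (w * Complex.I)‖ = Real.exp (-w.im) := by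
    rw [Complex.norm_exp]; simp
  have h3 := abs_norm_sub_norm_le (Complex.exp (-w * Complex.I)) (Complex.exp (w * Complex.I))
  rw [h1, h2] at h3
  have h4 : Real.exp (-|w.im|) ≤ Real.exp |w.im| / 2 := by
    have h5 : Real.exp (-|w.im|) ≤ 1 := Real.exp_le_one_iff.2 (by linarith)
    have h6 := Real.add_one_le_exp |w.im|
    linarith
  have h7 : Real.exp |w.im| / 2 ≤ |Real.exp w.im - Real.exp (-w.im)| := by
    rcases abs_cases w.im with ⟨h, _⟩ | ⟨h, _⟩ <;> rw [h] at h4 ⊢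
    · have := le_abs_self (Real.exp w.im - Real.exp (-w.im)); linarith
    · have := neg_le_abs (Real.exp w.im - Real.exp (-w.im))
      rw [neg_neg] at h4; linarith
  rw [Complex.sin]
  simp only [norm_div, norm_mul, Complex.norm_I, Complex.norm_ofNat]
  linarith

lemma sin_pi_zero {z : ℂ} (h : Complex.sin (Real.pi * z) = 0) : ∃ n : ℤ, z = n := by
  obtain ⟨k, hk⟩ := Complex.sin_eq_zero_iff.1 h
  refine ⟨k, ?_⟩
  have hp : (Real.pi : ℂ) ≠ 0 := by exact_mod_cast Real.pi_ne_zero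
  apply mul_left_cancel₀ hp
  rw [hk]; ring

lemma sin_pi_int (n : ℤ) : Complex.sin (Real.pi * (n : ℂ)) = 0 :=
  Complex.sin_eq_zero_iff.2 ⟨n, by ring⟩

lemma im_pi (z : ℂ) : |((Real.pi : ℂ) * z).im| = Real.pi * |z.im| := by
  simp [abs_mul, abs_of_pos Real.pi_pos]

/-- positive lower bound on compact sets -/
lemma compact_lower {K : Set ℂ} (hK : IsCompact K) {f : ℂ → ℂ} (hf : Continuous f)
    (h0 : ∀ z ∈ K, f z ≠ 0) :
    ∃ c : ℝ, 0 < c ∧ ∀ z ∈ K, c * Real.exp (Real.pi * |z.im|) ≤ ‖f z‖ := by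
  rcases K.eq_empty_or_nonempty with rfl | hne
  · exact ⟨1, one_pos, by simp⟩
  have hg : Continuous fun z : ℂ => ‖f z‖ / Real.exp (Real.pi * |z.im|) := by
    apply Continuous.div hf.norm
    · have := Complex.continuous_im
      fun_prop
    · intro z; exact (Real.exp_pos _).ne'
  obtain ⟨x, hx, hmin⟩ := hK.exists_isMinOn hne hg.continuousOn
  refine ⟨_, div_pos (norm_pos_iff.2 (h0 x hx)) (Real.exp_pos (Real.pi * |x.im|)), ?_⟩
  intro z hz
  have := hmin hz
  simp only [Set.mem_ofPred_eq] at this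
  exact (le_div_iff₀ (Real.exp_pos _)).1 this

lemma sin_lower (η : ℝ) (hη : 0 < η) :
    ∃ c : ℝ, 0 < c ∧ ∀ z : ℂ, (∀ j : ℤ, η ≤ ‖z - (j : ℂ)‖) →
      c * Real.exp (Real.pi * |z.im|) ≤ ‖Complex.sin (Real.pi * z)‖ := by
  let K : Set ℂ := Metric.closedBall 0 2 ∩ ⋂ j : ℤ, {z | η ≤ ‖z - (j : ℂ)‖}
  have hK : IsCompact K := by
    apply (isCompact_closedBall 0 2).inter_right
    apply isClosed_iInter
    intro j
    exact isClosed_le continuous_const (by fun_prop)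
  obtain ⟨c, hc, hcK⟩ := compact_lower hK (f := fun z => Complex.sin (Real.pi * z))
    (by fun_prop) (by
      rintro z ⟨_, hz⟩ h
      obtain ⟨n, hn⟩ := sin_pi_zero h
      have := Set.mem_iInter.1 hz n
      simp [hn] at this
      linarith)
  refine ⟨min c (1/4), by positivity, ?_⟩
  intro z hz
  have he := Real.exp_pos (Real.pi * |z.im|)
  by_cases hy : 1 ≤ |z.im|
  · have h1 := sin_norm_ge (Real.pi * z) (by
      rw [im_pi]; nlinarith [Real.pi_gt_three])
    rw [im_pi] at h1
    have := min_le_right c (1/4)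
    nlinarith
  · let n := ⌊z.re⌋
    have hmem : z - (n : ℂ) ∈ K := by
      refine ⟨?_, ?_⟩
      · rw [mem_closedBall_zero_iff]
        have h1 := Complex.norm_le_abs_re_add_abs_im (z - (n : ℂ))
        have h2 : |(z - (n : ℂ)).re| ≤ 1 := by
          simp only [Complex.sub_re, Complex.intCast_re]
          have h3 := Int.floor_le z.re
          have h4 := Int.lt_floor_add_one z.re
          rw [abs_le]; constructor <;> simp only [n] <;> linarith
        have h3 : (z - (n : ℂ)).im = z.im := by simp
        rw [h3] at h1
        push Not at hy
        linarith
      · refine Set.mem_iInter.2 fun j => ?_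
        have := hz (n + j)
        simp only [Set.mem_ofPred_eq]
        convert this using 2
        push_cast; ring
    have h1 := hcK _ hmem
    have h3 : (z - (n : ℂ)).im = z.im := by simp
    have h4 : ‖Complex.sin (Real.pi * (z - (n : ℂ)))‖ = ‖Complex.sin (Real.pi * z)‖ := by
      have : (Real.pi : ℂ) * (z - n) = Real.pi * z - n * Real.pi := by ring
      have hc : ‖Complex.cos ((n : ℂ) * Real.pi)‖ = 1 := by
        have h5 : Complex.cos ((n : ℂ) * Real.pi) = ((Real.cos (n * Real.pi) : ℝ) : ℂ) := by
          push_cast; rfl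
        rw [h5, Complex.norm_real, Real.norm_eq_abs, Real.abs_cos_int_mul_pi]
      rw [this, Complex.sin_sub, Complex.sin_int_mul_pi, mul_zero, sub_zero, norm_mul, hc, mul_one]
    rw [h3] at h1
    simp only [h4] at h1
    have := min_le_left c (1/4)
    nlinarith

lemma exists_G (s : Finset ℤ) : ∃ G : ℂ → ℂ, Differentiable ℂ G ∧
    ∀ z : ℂ, Complex.sin (Real.pi * z) = (∏ j ∈ s, (z - (j : ℂ))) * G z := by
  induction s using Finset.induction_on with
  | empty => exact ⟨fun z => Complex.sin (Real.pi * z), by fun_prop, by simp⟩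
  | insert a s ha ih =>
    obtain ⟨G, hG, h⟩ := ih
    have hGa : G a = 0 := by
      have := h a
      rw [sin_pi_int] at this
      rcases mul_eq_zero.1 this.symm with h1 | h1
      · obtain ⟨j, hj, h2⟩ := Finset.prod_eq_zero_iff.1 h1
        have : a = j := by exact_mod_cast sub_eq_zero.1 h2
        exact absurd (this ▸ hj) ha
      · exact h1
    refine ⟨dslope G a, ?_, ?_⟩
    · rw [← differentiableOn_univ]
      exact (Complex.differentiableOn_dslope Filter.univ_mem).2 hG.differentiableOn
    · intro z
      rw [h z, Finset.prod_insert ha]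
      have := sub_smul_dslope G (a : ℂ) z
      rw [hGa, sub_zero, smul_eq_mul] at this
      rw [← this]; ring

lemma G_ne {s : Finset ℤ} {G : ℂ → ℂ} (hG : Differentiable ℂ G)
    (h : ∀ z : ℂ, Complex.sin (Real.pi * z) = (∏ j ∈ s, (z - (j : ℂ))) * G z)
    {n : ℤ} (hn : n ∈ s) : G n ≠ 0 := by
  intro h0
  have hp : (Real.pi : ℂ) ≠ 0 := by exact_mod_cast Real.pi_ne_zero
  have hP : Differentiable ℂ fun z : ℂ => ∏ j ∈ s, (z - (j : ℂ)) := by fun_prop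
  have h1 := (hP n).hasDerivAt.mul (hG n).hasDerivAt
  have hPn : (∏ j ∈ s, ((n : ℂ) - (j : ℂ))) = 0 := Finset.prod_eq_zero hn (sub_self _)
  rw [h0, hPn] at h1
  have h2 : HasDerivAt (fun z : ℂ => Complex.sin (Real.pi * z))
      (Complex.cos (Real.pi * n) * (Real.pi * 1)) (n : ℂ) :=
    ((hasDerivAt_id (n : ℂ)).const_mul (Real.pi : ℂ)).csin
  have h3 : (fun z : ℂ => Complex.sin (Real.pi * z)) =
      (fun z : ℂ => ∏ j ∈ s, (z - (j : ℂ))) * G := by funext z; exact h z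
  rw [h3] at h2
  have h4 := h1.unique h2
  have h5 : Complex.cos (Real.pi * n) = 0 := by
    have : Complex.cos (Real.pi * n) * (Real.pi * 1) = 0 := by rw [← h4]; ring
    simpa [hp] using this
  have h6 := Complex.sin_sq_add_cos_sq (Real.pi * (n : ℂ))
  rw [sin_pi_int, h5] at h6
  simp at h6

/-- `F_Λ(z) = sin(πz) ∏_{j=-N}^{N} (z-λ_j)/(z-j)` extends to an entire function which
is a sine-type function with bandwidth `π`: its zero set is the real, uniformly
separated set `{λ̄_j}_{j∈ℤ}`, it is bounded by `C e^{π|Im z|}`, and it is bounded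
below by `c_η e^{π|Im z|}` away from the zeros. -/
theorem stmt9
    (N : ℕ) (hN : 0 < N)
    (L : ℝ) (hL0 : 0 ≤ L) (hL1 : L < 1)
    (Λ : ℤ → ℝ)
    (hdist : ∀ j k : ℤ, |j| ≤ (N : ℤ) → |k| ≤ (N : ℤ) → j ≠ k → Λ j ≠ Λ k)
    (hL : ∀ j : ℤ, |j| ≤ (N : ℤ) → |Λ j - (j : ℝ)| ≤ L) :
    ∃ FΛ : ℂ → ℂ, Differentiable ℂ FΛ ∧
      (∀ z : ℂ, (∀ j : ℤ, |j| ≤ (N : ℤ) → z ≠ (j : ℂ)) →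
        FΛ z = Complex.sin (Real.pi * z) *
          ∏ j ∈ Finset.Icc (-(N : ℤ)) (N : ℤ), ((z - (Λ j : ℂ)) / (z - (j : ℂ)))) ∧
      (∀ z : ℂ, FΛ z = 0 ↔ ∃ j : ℤ, z = (lambdaBar N Λ j : ℂ)) ∧
      (∃ ε : ℝ, 0 < ε ∧ ∀ i j : ℤ, i ≠ j → ε ≤ |lambdaBar N Λ i - lambdaBar N Λ j|) ∧
      (∃ C : ℝ, 0 < C ∧ ∀ z : ℂ,
        ‖FΛ z‖ ≤ C * Real.exp (Real.pi * |z.im|)) ∧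
      (∀ η : ℝ, 0 < η → η < 1 → ∃ c : ℝ, 0 < c ∧ ∀ z : ℂ,
        (∀ j : ℤ, η ≤ ‖z - (lambdaBar N Λ j : ℂ)‖) →
        c * Real.exp (Real.pi * |z.im|) ≤ ‖FΛ z‖) := by
  classical
  set s := Finset.Icc (-(N : ℤ)) (N : ℤ) with hs
  have mem_s : ∀ j : ℤ, j ∈ s ↔ |j| ≤ (N : ℤ) := by
    intro j; rw [hs, Finset.mem_Icc, abs_le]
  obtain ⟨G, hG, hsin⟩ := exists_G s
  let F : ℂ → ℂ := fun z => G z * ∏ j ∈ s, (z - (Λ j : ℂ))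
  have hF : Differentiable ℂ F := by
    have : Differentiable ℂ fun z : ℂ => ∏ j ∈ s, (z - (Λ j : ℂ)) := by fun_prop
    exact hG.mul this
  have hform : ∀ z : ℂ, (∀ j : ℤ, |j| ≤ (N : ℤ) → z ≠ (j : ℂ)) →
        F z = Complex.sin (Real.pi * z) * ∏ j ∈ s, ((z - (Λ j : ℂ)) / (z - (j : ℂ))) := by
    intro z hz
    have hP : (∏ j ∈ s, (z - (j : ℂ))) ≠ 0 :=
      Finset.prod_ne_zero_iff.2 fun j hj => sub_ne_zero.2 (hz j ((mem_s j).1 hj))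
    rw [hsin, Finset.prod_div_distrib]
    simp only [F]
    field_simp
  have bar_in : ∀ j : ℤ, |j| ≤ (N : ℤ) → lambdaBar N Λ j = Λ j := fun j hj => by
    simp [lambdaBar, hj]
  have bar_out : ∀ j : ℤ, ¬ |j| ≤ (N : ℤ) → lambdaBar N Λ j = j := fun j hj => by
    simp [lambdaBar, hj]
  have hzero : ∀ z : ℂ, F z = 0 ↔ ∃ j : ℤ, z = (lambdaBar N Λ j : ℂ) := by
    intro z
    constructor
    · intro h
      rcases mul_eq_zero.1 h with h1 | h1
      · have h2 := hsin z
        rw [h1, mul_zero] at h2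
        obtain ⟨n, rfl⟩ := sin_pi_zero h2
        have hn : ¬ |n| ≤ (N : ℤ) := fun hn => G_ne hG hsin ((mem_s n).2 hn) h1
        exact ⟨n, by rw [bar_out n hn]; simp⟩
      · obtain ⟨j, hj, h2⟩ := Finset.prod_eq_zero_iff.1 h1
        exact ⟨j, by rw [bar_in j ((mem_s j).1 hj)]; exact sub_eq_zero.1 h2⟩
    · rintro ⟨j, rfl⟩
      by_cases hj : |j| ≤ (N : ℤ)
      · rw [bar_in j hj]
        exact mul_eq_zero_of_right _ (Finset.prod_eq_zero ((mem_s j).2 hj) (sub_self _))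
      · rw [bar_out j hj]
        apply mul_eq_zero_of_left
        have h2 := hsin (j : ℂ)
        rw [sin_pi_int] at h2
        rcases mul_eq_zero.1 h2.symm with h1 | h1
        · obtain ⟨k, hk, h3⟩ := Finset.prod_eq_zero_iff.1 h1
          have : j = k := by exact_mod_cast sub_eq_zero.1 h3
          exact absurd ((mem_s j).1 (this ▸ hk)) hj
        · simpa using h1
  -- distance facts for large z
  have hbig : ∀ z : ℂ, (N : ℝ) + 2 ≤ ‖z‖ → ∀ j : ℤ, |j| ≤ (N : ℤ) →
      2 ≤ ‖z - (j : ℂ)‖ ∧ ‖z - (Λ j : ℂ)‖ ≤ ‖z - (j : ℂ)‖ + 1 ∧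
      ‖z - (j : ℂ)‖ - 1 ≤ ‖z - (Λ j : ℂ)‖ := by
    intro z hz j hj
    have h1 : ‖(j : ℂ)‖ ≤ N := by
      rw [Complex.norm_intCast]; exact_mod_cast hj
    have h2 := norm_sub_norm_le z (j : ℂ)
    have h3 : ‖(Λ j : ℂ) - (j : ℂ)‖ ≤ 1 := by
      have : (Λ j : ℂ) - (j : ℂ) = ((Λ j - j : ℝ) : ℂ) := by push_cast; rfl
      rw [this, Complex.norm_real, Real.norm_eq_abs]
      linarith [hL j hj]
    have h4 := norm_sub_le (z - (j : ℂ)) ((Λ j : ℂ) - (j : ℂ))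
    have h5 := norm_add_le (z - (Λ j : ℂ)) ((Λ j : ℂ) - (j : ℂ))
    rw [sub_sub_sub_cancel_right] at h4
    rw [sub_add_sub_cancel] at h5
    refine ⟨by linarith, by linarith, by linarith⟩
  have hne : ∀ z : ℂ, (N : ℝ) + 2 ≤ ‖z‖ → ∀ j : ℤ, |j| ≤ (N : ℤ) → z ≠ (j : ℂ) := by
    intro z hz j hj h
    have := (hbig z hz j hj).1
    simp [h] at this
    linarith
  refine ⟨F, hF, hform, hzero, ?_, ?_, ?_⟩
  · -- separation
    have hfin : ∃ ε : ℝ, 0 < ε ∧ ∀ p ∈ (s ×ˢ s).filter (fun p => p.1 ≠ p.2),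
        ε ≤ |Λ p.1 - Λ p.2| := by
      rcases ((s ×ˢ s).filter (fun p => p.1 ≠ p.2)).eq_empty_or_nonempty with h | h
      · exact ⟨1, one_pos, by simp [h]⟩
      · obtain ⟨q, hq, hmin⟩ := Finset.exists_min_image _ (fun p : ℤ × ℤ => |Λ p.1 - Λ p.2|) h
        refine ⟨|Λ q.1 - Λ q.2|, ?_, hmin⟩
        rw [Finset.mem_filter, Finset.mem_product] at hq
        exact abs_pos.2 (sub_ne_zero.2 (hdist _ _ ((mem_s _).1 hq.1.1) ((mem_s _).1 hq.1.2) hq.2))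
    obtain ⟨ε, hε, hmin⟩ := hfin
    have hmix : ∀ i j : ℤ, |i| ≤ (N : ℤ) → ¬ |j| ≤ (N : ℤ) → 1 - L ≤ |Λ i - j| := by
      intro i j hi hj
      have h1 : (1 : ℝ) ≤ |(i : ℝ) - j| := by
        have : 1 ≤ |i - j| := Int.one_le_abs (by rintro h; apply hj; rwa [← sub_eq_zero.1 h])
        exact_mod_cast this
      have h2 := abs_sub_le (i : ℝ) (Λ i) j
      rw [abs_sub_comm (i : ℝ) (Λ i)] at h2
      linarith [hL i hi]
    refine ⟨min ε (1 - L), lt_min hε (by linarith), ?_⟩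
    intro i j hij
    by_cases hi : |i| ≤ (N : ℤ) <;> by_cases hj : |j| ≤ (N : ℤ)
    · rw [bar_in i hi, bar_in j hj]
      refine (min_le_left _ _).trans (hmin (i, j) ?_)
      rw [Finset.mem_filter, Finset.mem_product]
      exact ⟨⟨(mem_s i).2 hi, (mem_s j).2 hj⟩, hij⟩
    · rw [bar_in i hi, bar_out j hj]
      exact (min_le_right _ _).trans (hmix i j hi hj)
    · rw [bar_out i hi, bar_in j hj, abs_sub_comm]
      exact (min_le_right _ _).trans (hmix j i hj hi)
    · rw [bar_out i hi, bar_out j hj]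
      have h1 : (1 : ℝ) ≤ |(i : ℝ) - j| := by
        have : 1 ≤ |i - j| := Int.one_le_abs (sub_ne_zero.2 hij)
        exact_mod_cast this
      exact (min_le_right _ _).trans (by linarith)
  · -- upper bound
    obtain ⟨M, hM⟩ := (isCompact_closedBall (0 : ℂ) (N + 2)).exists_bound_of_continuousOn
      hF.continuous.continuousOn
    refine ⟨max M (2 ^ s.card), lt_max_of_lt_right (by positivity), ?_⟩
    intro z
    by_cases hz : ‖z‖ ≤ N + 2
    · have h1 := hM z (mem_closedBall_zero_iff.2 hz)
      have h2 : 1 ≤ Real.exp (Real.pi * |z.im|) :=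
        Real.one_le_exp (mul_nonneg Real.pi_pos.le (abs_nonneg _))
      calc ‖F z‖ ≤ max M (2 ^ s.card) := h1.trans (le_max_left _ _)
        _ = max M (2 ^ s.card) * 1 := by ring
        _ ≤ _ := mul_le_mul_of_nonneg_left h2 (le_max_of_le_right (by positivity))
    · push Not at hz
      rw [hform z (hne z hz.le), norm_mul, norm_prod]
      have h1 : ∏ j ∈ s, ‖(z - (Λ j : ℂ)) / (z - (j : ℂ))‖ ≤ 2 ^ s.card := by
        rw [← Finset.prod_const]
        apply Finset.prod_le_prod
        · intros; positivity
        intro j hj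
        obtain ⟨a, b, -⟩ := hbig z hz.le j ((mem_s j).1 hj)
        rw [norm_div, div_le_iff₀ (by linarith)]
        linarith
      have h2 := sin_norm_le (Real.pi * z)
      rw [im_pi] at h2
      rw [mul_comm]
      exact mul_le_mul (h1.trans (le_max_right _ _)) h2 (norm_nonneg _)
        (le_max_of_le_right (by positivity))
  · -- lower bound
    intro η hη hη1
    let K : Set ℂ := Metric.closedBall 0 (N + 2) ∩
      ⋂ j : ℤ, {z | η ≤ ‖z - (lambdaBar N Λ j : ℂ)‖}
    have hK : IsCompact K := by
      apply (isCompact_closedBall 0 _).inter_right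
      apply isClosed_iInter
      intro j
      exact isClosed_le continuous_const (by fun_prop)
    obtain ⟨c₁, hc₁, hcK⟩ := compact_lower hK hF.continuous (by
      rintro z ⟨_, hz⟩ h
      obtain ⟨n, hn⟩ := (hzero z).1 h
      have := Set.mem_iInter.1 hz n
      simp [hn] at this
      linarith)
    obtain ⟨c₂, hc₂, hcs⟩ := sin_lower η hη
    refine ⟨min c₁ (c₂ * (1/2) ^ s.card), by positivity, ?_⟩
    intro z hz
    have he := Real.exp_pos (Real.pi * |z.im|)
    by_cases hzn : ‖z‖ ≤ N + 2
    · exact (mul_le_mul_of_nonneg_right (min_le_left _ _) he.le).trans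
        (hcK z ⟨mem_closedBall_zero_iff.2 hzn, Set.mem_iInter.2 hz⟩)
    · push Not at hzn
      refine (mul_le_mul_of_nonneg_right (min_le_right _ _) he.le).trans ?_
      rw [hform z (hne z hzn.le), norm_mul, norm_prod]
      have h1 : (1/2 : ℝ) ^ s.card ≤ ∏ j ∈ s, ‖(z - (Λ j : ℂ)) / (z - (j : ℂ))‖ := by
        rw [← Finset.prod_const]
        apply Finset.prod_le_prod
        · intros; norm_num
        intro j hj
        obtain ⟨a, -, b⟩ := hbig z hzn.le j ((mem_s j).1 hj)
        rw [norm_div, le_div_iff₀ (by linarith)]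
        linarith
      have h2 := hcs z (by
        intro j
        by_cases hj : |j| ≤ (N : ℤ)
        · linarith [(hbig z hzn.le j hj).1]
        · have := hz j
          rw [bar_out j hj] at this
          simpa using this)
      rw [mul_right_comm]
      exact mul_le_mul h2 h1 (by positivity) (norm_nonneg _)
end

section
/- Let m be a positive integer and β ≥ 1, and let φ_{β,m} be the sinh-type window function. Then there exists an absolute constant C (independent of β, m) such that ∫_{β/m}^{∞} | φ̂_{β,m}(w) | dw ≤ C β e^{−β}, and by evenness the same bound holds for ∫_{−∞}^{−β/m} | φ̂_{β,m}(w) | dw. -/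
open MeasureTheory

/-- The Fourier transform with the convention `f̂(w) = (1/√(2π)) ∫ f(x) e^{-iwx} dx`. -/
noncomputable def fourierTf (f : ℝ → ℂ) (w : ℝ) : ℂ :=
  (1 / Real.sqrt (2 * Real.pi)) * ∫ x : ℝ, f x * Complex.exp (-(Complex.I * w * x))

/-- The sinh-type window function `φ_{β,m}`. -/
noncomputable def sinhWindow (β m : ℝ) (x : ℝ) : ℝ :=
  if |x| ≤ m then Real.sinh (β * Real.sqrt (1 - x ^ 2 / m ^ 2)) / Real.sinh β else 0

open Real MeasureTheory

lemma osc_deriv (r θ : ℝ) : HasDerivAt (fun θ : ℝ => Complex.exp (Complex.I * ((-(r * sin θ) : ℝ) : ℂ)))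
    (Complex.exp (Complex.I * ((-(r * sin θ) : ℝ) : ℂ)) * (Complex.I * ((-(r * cos θ) : ℝ) : ℂ))) θ := by
  have h : HasDerivAt (fun θ : ℝ => -(r * sin θ)) (-(r * cos θ)) θ :=
    ((hasDerivAt_sin θ).const_mul r).neg
  exact ((h.ofReal_comp).const_mul Complex.I).cexp

lemma osc_norm (x : ℝ) : ‖Complex.exp (Complex.I * (x : ℂ))‖ = 1 := by
  rw [mul_comm]; exact Complex.norm_exp_ofReal_mul_I x

lemma L_small (r : ℝ) (hr : 0 ≤ r) :
    ‖∫ θ in (-(π/2))..(3*π/2), (sin θ : ℂ) * Complex.exp (Complex.I * ((-(r * sin θ) : ℝ) : ℂ))‖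
      ≤ r * (2 * π) := by
  have h0 : ∫ θ in (-(π/2))..(3*π/2), ((sin θ : ℝ) : ℂ) = 0 := by
    rw [intervalIntegral.integral_ofReal, integral_sin]
    have : cos (3*π/2) = 0 := by
      rw [show 3*π/2 = π/2 + π by ring, cos_add_pi, cos_pi_div_two]; simp
    rw [this]; simp
  have h1 : ∫ θ in (-(π/2))..(3*π/2), (sin θ : ℂ) * Complex.exp (Complex.I * ((-(r * sin θ) : ℝ) : ℂ))
      = ∫ θ in (-(π/2))..(3*π/2), ((sin θ : ℝ) : ℂ) * (Complex.exp (Complex.I * ((-(r * sin θ) : ℝ) : ℂ)) - 1) := by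
    have : ∀ θ : ℝ, ((sin θ : ℝ) : ℂ) * (Complex.exp (Complex.I * ((-(r * sin θ) : ℝ) : ℂ)) - 1)
      = ((sin θ : ℝ) : ℂ) * Complex.exp (Complex.I * ((-(r * sin θ) : ℝ) : ℂ)) - ((sin θ : ℝ) : ℂ) := by
      intro θ; ring
    simp_rw [this]
    rw [intervalIntegral.integral_sub, h0, sub_zero]
    · apply Continuous.intervalIntegrable; fun_prop
    · apply Continuous.intervalIntegrable; fun_prop
  rw [h1]
  have h2 := intervalIntegral.norm_integral_le_of_norm_le_const (a := -(π/2)) (b := 3*π/2) (C := r)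
    (f := fun θ : ℝ => ((sin θ : ℝ) : ℂ) * (Complex.exp (Complex.I * ((-(r * sin θ) : ℝ) : ℂ)) - 1)) (by
      intro θ _
      rw [norm_mul, Complex.norm_real]
      have a1 : ‖sin θ‖ ≤ 1 := abs_sin_le_one θ
      have a2 := norm_exp_I_mul_ofReal_sub_one_le (x := -(r * sin θ))
      rw [norm_neg, norm_mul, Real.norm_of_nonneg hr] at a2
      nlinarith [norm_nonneg (sin θ), norm_nonneg (Complex.exp (Complex.I * ((-(r * sin θ) : ℝ) : ℂ)) - 1),
        mul_le_mul_of_nonneg_left a1 hr])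
  rwa [show |3*π/2 - -(π/2)| = 2 * π by rw [abs_of_nonneg] <;> linarith [pi_pos]] at h2

lemma L_mid (r δ : ℝ) (hr : 0 < r) (hδ : 0 < δ) (hδ' : δ < π/2) :
    ‖∫ θ in (-(π/2-δ))..(π/2-δ), ((sin θ : ℝ) : ℂ) * Complex.exp (Complex.I * ((-(r * sin θ) : ℝ) : ℂ))‖
      ≤ 4 / (r * δ) := by
  have hcos : ∀ x ∈ Set.uIcc (-(π/2-δ)) (π/2-δ), 0 < cos x := by
    intro x hx
    rw [Set.uIcc_of_le (by linarith)] at hx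
    exact cos_pos_of_mem_Ioo ⟨by linarith [hx.1], by linarith [hx.2]⟩
  have hsec : IntervalIntegrable (fun x : ℝ => 1 / cos x ^ 2) volume (-(π/2-δ)) (π/2-δ) := by
    apply ContinuousOn.intervalIntegrable
    apply ContinuousOn.div continuousOn_const (by fun_prop)
    intro x hx
    exact pow_ne_zero _ (hcos x hx).ne'
  have hsecC : IntervalIntegrable (fun x : ℝ => ((1 / cos x ^ 2 : ℝ) : ℂ)) volume (-(π/2-δ)) (π/2-δ) := by
    apply ContinuousOn.intervalIntegrable
    apply Complex.continuous_ofReal.comp_continuousOn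
    apply ContinuousOn.div continuousOn_const (by fun_prop)
    intro x hx
    exact pow_ne_zero _ (hcos x hx).ne'
  have ibp := intervalIntegral.integral_mul_deriv_eq_deriv_mul (a := -(π/2-δ)) (b := π/2-δ)
    (u := fun x : ℝ => ((tan x : ℝ) : ℂ)) (u' := fun x : ℝ => ((1 / cos x ^ 2 : ℝ) : ℂ))
    (v := fun θ : ℝ => Complex.exp (Complex.I * ((-(r * sin θ) : ℝ) : ℂ)))
    (v' := fun θ : ℝ => Complex.exp (Complex.I * ((-(r * sin θ) : ℝ) : ℂ)) * (Complex.I * ((-(r * cos θ) : ℝ) : ℂ)))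
    (fun x hx => (hasDerivAt_tan (hcos x hx).ne').ofReal_comp)
    (fun x _ => osc_deriv r x) hsecC (by apply Continuous.intervalIntegrable; fun_prop)
  have hT : tan (π/2-δ) ≤ 1/δ := by
    rw [tan_pi_div_two_sub, ← one_div]
    exact one_div_le_one_div_of_le hδ (lt_tan hδ hδ').le
  have hT0 : 0 ≤ tan (π/2-δ) := tan_nonneg_of_nonneg_of_le_pi_div_two (by linarith) (by linarith)
  have hI : ‖∫ x in (-(π/2-δ))..(π/2-δ), ((1 / cos x ^ 2 : ℝ) : ℂ) * Complex.exp (Complex.I * ((-(r * sin x) : ℝ) : ℂ))‖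
      ≤ 2 * tan (π/2-δ) := by
    refine (intervalIntegral.norm_integral_le_of_norm_le (by linarith) (g := fun x => 1 / cos x ^2) ?_ hsec).trans ?_
    · refine Filter.Eventually.of_forall fun x _ => ?_
      rw [norm_mul, osc_norm, mul_one, Complex.norm_real, Real.norm_of_nonneg (by positivity)]
    · rw [intervalIntegral.integral_eq_sub_of_hasDerivAt (fun x hx => (hasDerivAt_tan (hcos x hx).ne')) hsec, tan_neg]
      linarith
  have hJ : ∫ x in (-(π/2-δ))..(π/2-δ), ((tan x : ℝ) : ℂ) * (Complex.exp (Complex.I * ((-(r * sin x) : ℝ) : ℂ)) * (Complex.I * ((-(r * cos x) : ℝ) : ℂ)))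
     = (-(Complex.I * r)) * ∫ θ in (-(π/2-δ))..(π/2-δ), ((sin θ : ℝ) : ℂ) * Complex.exp (Complex.I * ((-(r * sin θ) : ℝ) : ℂ)) := by
    rw [← intervalIntegral.integral_const_mul]
    apply intervalIntegral.integral_congr
    intro x hx
    have := tan_mul_cos (hcos x hx).ne'
    simp only
    rw [← this]
    push_cast
    ring
  rw [hJ] at ibp
  have hn := congrArg norm ibp
  rw [norm_mul, norm_neg, norm_mul, Complex.norm_I, one_mul, Complex.norm_real, Real.norm_of_nonneg hr.le] at hn
  have hb : r * ‖∫ θ in (-(π/2-δ))..(π/2-δ), ((sin θ : ℝ) : ℂ) * Complex.exp (Complex.I * ((-(r * sin θ) : ℝ) : ℂ))‖ ≤ 4 * (1/δ) := by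
    rw [hn]
    refine (norm_sub_le _ _).trans ?_
    refine (add_le_add (norm_sub_le _ _) hI).trans ?_
    rw [norm_mul, norm_mul, osc_norm, osc_norm, Complex.norm_real, Complex.norm_real, tan_neg, norm_neg, Real.norm_of_nonneg hT0]
    linarith
  rw [show 4 / (r*δ) = 4*(1/δ)/r by field_simp, le_div_iff₀ hr]
  linarith

lemma L_large (r : ℝ) (hr : 1 ≤ r) :
    ‖∫ θ in (-(π/2))..(3*π/2), ((sin θ : ℝ) : ℂ) * Complex.exp (Complex.I * ((-(r * sin θ) : ℝ) : ℂ))‖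
      ≤ 12 * r ^ (-(1/2) : ℝ) := by
  set f : ℝ → ℂ := fun θ => ((sin θ : ℝ) : ℂ) * Complex.exp (Complex.I * ((-(r * sin θ) : ℝ) : ℂ)) with hf
  have hc : Continuous f := by fun_prop
  have hii : ∀ a b, IntervalIntegrable f volume a b := fun a b => hc.intervalIntegrable a b
  have h1 : ∫ θ in (π/2)..(3*π/2), f θ = ∫ θ in (-(π/2))..(π/2), f θ := by
    have := intervalIntegral.integral_comp_sub_left (a := -(π/2)) (b := π/2) f π
    rw [show π - π/2 = π/2 by ring, show π - -(π/2) = 3*π/2 by ring] at this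
    rw [← this]
    simp only [hf, sin_pi_sub]
  set δ : ℝ := r ^ (-(1/2) : ℝ) with hδ
  have hr0 : 0 < r := by linarith
  have hδ0 : 0 < δ := rpow_pos_of_pos hr0 _
  have hδ1 : δ ≤ 1 := rpow_le_one_of_one_le_of_nonpos hr (by norm_num)
  have hδδ : r * (δ * δ) = 1 := by
    rw [hδ, ← rpow_add hr0]; norm_num
    rw [rpow_neg_one]; field_simp
  have hpi := pi_gt_three
  have hm := L_mid r δ hr0 hδ0 (by linarith)
  have e : 4 / (r * δ) = 4 * δ := by
    rw [div_eq_iff (by positivity)]; linear_combination -4 * hδδ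
  rw [e] at hm
  have hfb : ∀ x, ‖f x‖ ≤ 1 := by
    intro x
    rw [hf]; simp only
    rw [norm_mul, osc_norm, mul_one, Complex.norm_real]; exact abs_sin_le_one x
  have ha := intervalIntegral.norm_integral_le_of_norm_le_const (a := -(π/2)) (b := -(π/2-δ)) (f := f) (fun x _ => hfb x)
  have hb := intervalIntegral.norm_integral_le_of_norm_le_const (a := (π/2-δ)) (b := π/2) (f := f) (fun x _ => hfb x)
  rw [show -(π/2-δ) - -(π/2) = δ by ring, abs_of_pos hδ0] at ha
  rw [show (π/2) - (π/2-δ) = δ by ring, abs_of_pos hδ0] at hb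
  rw [← intervalIntegral.integral_add_adjacent_intervals (hii (-(π/2)) (π/2)) (hii _ _), h1,
   ← intervalIntegral.integral_add_adjacent_intervals (hii (-(π/2)) (π/2-δ)) (hii _ _),
   ← intervalIntegral.integral_add_adjacent_intervals (hii (-(π/2)) (-(π/2-δ))) (hii _ _)]
  set A := ∫ x in (-(π/2))..(-(π/2-δ)), f x
  set B := ∫ x in (-(π/2-δ))..(π/2-δ), f x
  set D := ∫ x in (π/2-δ)..(π/2), f x
  have t1 := norm_add_le (A + B + D) (A + B + D)
  have t2 := norm_add_le (A + B) D
  have t3 := norm_add_le A B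
  change ‖B‖ ≤ _ at hm
  linarith

/-- contour shift -/
lemma shift (β s r : ℝ) (hr : 0 < r) (hs : r ^ 2 = s ^ 2 - β ^ 2) (hs0 : 0 < s) :
    ∫ θ in (-(π/2))..(3*π/2), Complex.exp (β * Complex.cos θ - Complex.I * s * Complex.sin θ) * Complex.cos θ
    = (Complex.I * (β / r)) * ∫ θ in (-(π/2))..(3*π/2), ((sin θ : ℝ) : ℂ) * Complex.exp (Complex.I * ((-(r * sin θ) : ℝ) : ℂ)) := by
  set σ : ℝ := arsinh (-β / r) with hσ
  have hsinh : sinh σ = -β / r := sinh_arsinh _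
  have hcosh : cosh σ = s / r := by
    have h1 := cosh_sq σ
    rw [hsinh] at h1
    have h2 : cosh σ ^ 2 = (s / r) ^ 2 := by
      rw [h1]; field_simp; linarith
    exact (pow_left_inj₀ (cosh_pos σ).le (by positivity) two_ne_zero).1 h2
  set q : ℂ → ℂ := fun z => Complex.exp (β * Complex.cos z - Complex.I * s * Complex.sin z) * Complex.cos z with hq
  have hd : Differentiable ℂ q := by fun_prop
  have hper : ∀ z, q (z + 2 * π) = q z := by
    intro z; simp only [hq, Complex.cos_add_two_pi, Complex.sin_add_two_pi]
  have hrect := Complex.integral_boundary_rect_eq_zero_of_differentiableOn q ⟨-(π/2), 0⟩ ⟨3*π/2, σ⟩ hd.differentiableOn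
  simp only at hrect
  have hside : ∫ y in (0:ℝ)..σ, q (((3*π/2 : ℝ) : ℂ) + y * Complex.I) = ∫ y in (0:ℝ)..σ, q (((-(π/2) : ℝ) : ℂ) + y * Complex.I) := by
    congr 1; ext y
    rw [← hper (((-(π/2) : ℝ) : ℂ) + y * Complex.I)]
    congr 1; push_cast; ring
  rw [hside, add_sub_cancel_right, sub_eq_zero] at hrect
  have hl : ∫ θ in (-(π/2))..(3*π/2), q θ = ∫ x in (-(π/2))..(3*π/2), q ((x : ℂ) + ((0:ℝ):ℂ) * Complex.I) := by simp
  change ∫ θ in (-(π/2))..(3*π/2), q θ = _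
  rw [hl, hrect]
  have hE : ∀ x : ℝ, q ((x : ℂ) + (σ : ℂ) * Complex.I) =
     Complex.I * (s / r ^ 2) * (Complex.exp (Complex.I * ((-(r * sin x) : ℝ) : ℂ)) * (Complex.I * ((-(r * cos x) : ℝ) : ℂ)))
      + Complex.I * (β / r) * (((sin x : ℝ) : ℂ) * Complex.exp (Complex.I * ((-(r * sin x) : ℝ) : ℂ))) := by
    intro x
    have hrC : (r : ℂ) ≠ 0 := by exact_mod_cast hr.ne'
    have c1 : Complex.cosh (σ : ℂ) = s / r := by rw [← Complex.ofReal_cosh, hcosh]; push_cast; rfl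
    have c2 : Complex.sinh (σ : ℂ) = -β / r := by rw [← Complex.ofReal_sinh, hsinh]; push_cast; rfl
    have hsC : (r : ℂ) ^ 2 = (s : ℂ) ^ 2 - (β : ℂ) ^ 2 := by exact_mod_cast hs
    simp only [hq]
    rw [Complex.cos_add_mul_I, Complex.sin_add_mul_I, c1, c2]
    have hexp : (β : ℂ) * (Complex.cos x * (s / r) - Complex.sin x * (-β / r) * Complex.I) -
        Complex.I * s * (Complex.sin x * (s / r) + Complex.cos x * (-β / r) * Complex.I)
        = Complex.I * ((-(r * sin x) : ℝ) : ℂ) := by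
      push_cast
      field_simp
      linear_combination (-(Complex.I * Complex.sin x)) * (-hsC) + (Complex.cos x * s * β) * Complex.I_sq
    rw [hexp]
    push_cast
    field_simp
    linear_combination (Complex.cos x * s) * Complex.I_sq
  simp_rw [hE]
  rw [intervalIntegral.integral_add, intervalIntegral.integral_const_mul, intervalIntegral.integral_const_mul,
    intervalIntegral.integral_eq_sub_of_hasDerivAt (fun x _ => osc_deriv r x)]
  · have : sin (3*π/2) = sin (-(π/2)) := by
      rw [show 3*π/2 = -(π/2) + 2*π by ring, sin_add_two_pi]
    rw [this]; simp
  · apply Continuous.intervalIntegrable; fun_prop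
  · apply Continuous.intervalIntegrable; fun_prop
  · apply Continuous.intervalIntegrable; fun_prop

lemma P_bound (β s : ℝ) (hβ : 0 < β) (hs : β < s) :
    ‖∫ θ in (-(π/2))..(3*π/2), Complex.exp (β * Complex.cos θ - Complex.I * s * Complex.sin θ) * Complex.cos θ‖
     ≤ 40 * β * (1 + (s - β)) ^ (-(3/2) : ℝ) := by
  have hpos : 0 < s ^ 2 - β ^ 2 := by nlinarith
  set r := √(s ^ 2 - β ^ 2) with hrdef
  have hr : 0 < r := sqrt_pos.2 hpos
  have hr2 : r ^ 2 = s ^ 2 - β ^ 2 := sq_sqrt hpos.le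
  rw [shift β s r hr hr2 (by linarith)]
  have hx : s - β ≤ r := by
    apply le_sqrt_of_sq_le; nlinarith
  have hn : ‖Complex.I * ((β : ℂ) / r)‖ = β / r := by
    rw [norm_mul, Complex.norm_I, one_mul, norm_div, Complex.norm_real, Complex.norm_real,
      Real.norm_of_nonneg hβ.le, Real.norm_of_nonneg hr.le]
  rw [norm_mul, hn]
  have h2 : (2:ℝ) ^ (-(3/2) : ℝ) ≥ 7/20 := by
    have e : ((2:ℝ) ^ (-(3/2) : ℝ)) ^ 2 = 1/8 := by
      rw [← rpow_natCast, ← rpow_mul (by norm_num)]; norm_num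
    have : (0:ℝ) < (2:ℝ) ^ (-(3/2) : ℝ) := by positivity
    nlinarith
  rcases le_total (s - β) 1 with h | h
  · have a := L_small r hr.le
    have b : (2:ℝ) ^ (-(3/2) : ℝ) ≤ (1 + (s - β)) ^ (-(3/2) : ℝ) :=
      rpow_le_rpow_of_nonpos (by linarith) (by linarith) (by norm_num)
    calc _ ≤ β / r * (r * (2 * π)) := by gcongr
      _ = β * (2 * π) := by field_simp
      _ ≤ 40 * β * (7/20) := by nlinarith [pi_lt_d2]
      _ ≤ _ := by gcongr; linarith
  · have a := L_large r (h.trans hx)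
    have b : (2 * (s - β)) ^ (-(3/2) : ℝ) ≤ (1 + (s - β)) ^ (-(3/2) : ℝ) :=
      rpow_le_rpow_of_nonpos (by linarith) (by linarith) (by norm_num)
    rw [mul_rpow (by norm_num) (by linarith)] at b
    have c : r ^ (-(3/2) : ℝ) ≤ (s - β) ^ (-(3/2) : ℝ) :=
      rpow_le_rpow_of_nonpos (by linarith) hx (by norm_num)
    have d : r ^ (-(1/2) : ℝ) = r * r ^ (-(3/2) : ℝ) := by
      nth_rewrite 2 [← rpow_one r]
      rw [← rpow_add hr]; norm_num
    have e : 0 < (s - β) ^ (-(3/2) : ℝ) := rpow_pos_of_pos (by linarith) _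
    calc _ ≤ β / r * (12 * r ^ (-(1/2) : ℝ)) := by gcongr
      _ = 12 * β * r ^ (-(3/2) : ℝ) := by rw [d]; field_simp
      _ ≤ 12 * β * (s - β) ^ (-(3/2) : ℝ) := by gcongr
      _ ≤ 40 * β * (7/20 * (s - β) ^ (-(3/2) : ℝ)) := by nlinarith [mul_pos hβ e]
      _ ≤ 40 * β * (2 ^ (-(3/2) : ℝ) * (s - β) ^ (-(3/2) : ℝ)) := by gcongr
      _ ≤ _ := by gcongr

lemma fold (β s : ℝ) :
    ∫ θ in (-(π/2))..(π/2), ((sinh (β * cos θ) : ℝ) : ℂ) * ((cos θ : ℝ) : ℂ) * Complex.exp (-(Complex.I * s * sin θ))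
    = (1/2) * ∫ θ in (-(π/2))..(3*π/2), Complex.exp (β * Complex.cos θ - Complex.I * s * Complex.sin θ) * Complex.cos θ := by
  set p : ℝ → ℂ := fun θ => Complex.exp (β * Complex.cos θ - Complex.I * s * Complex.sin θ) * Complex.cos θ with hp
  have hc : Continuous p := by fun_prop
  have hii : ∀ a b, IntervalIntegrable p volume a b := fun a b => hc.intervalIntegrable a b
  have h1 : ∫ θ in (π/2)..(3*π/2), p θ = ∫ θ in (-(π/2))..(π/2), p (π - θ) := by
    have := intervalIntegral.integral_comp_sub_left (a := -(π/2)) (b := π/2) p π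
    rw [show π - π/2 = π/2 by ring, show π - -(π/2) = 3*π/2 by ring] at this
    rw [← this]
  change _ = (1/2) * ∫ θ in (-(π/2))..(3*π/2), p θ
  rw [← intervalIntegral.integral_add_adjacent_intervals (hii (-(π/2)) (π/2)) (hii _ _), h1,
    ← intervalIntegral.integral_add (hii _ _) (by apply Continuous.intervalIntegrable; fun_prop),
    ← intervalIntegral.integral_const_mul]
  congr 1; ext θ
  simp only [hp]
  push_cast
  rw [Complex.cos_pi_sub, Complex.sin_pi_sub, Complex.sinh, mul_neg (β : ℂ), sub_eq_add_neg (_ * _) (_ * _),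
    sub_eq_add_neg (-(_ * _)) (_ * _), Complex.exp_add, Complex.exp_add]
  ring

lemma window_ft (β m w : ℝ) (hm : 0 < m) :
    ∫ x : ℝ, (sinhWindow β m x : ℂ) * Complex.exp (-(Complex.I * w * x))
    = ((m / sinh β : ℝ) : ℂ) * ((1/2) * ∫ θ in (-(π/2))..(3*π/2),
      Complex.exp (β * Complex.cos θ - Complex.I * (m * w : ℝ) * Complex.sin θ) * Complex.cos θ) := by
  set g : ℝ → ℂ := fun x => ((sinh (β * √(1 - x ^ 2 / m ^ 2)) / sinh β : ℝ) : ℂ) * Complex.exp (-(Complex.I * w * x)) with hg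
  have hgc : Continuous g := by
    have : Continuous fun x : ℝ => sinh (β * √(1 - x ^ 2 / m ^ 2)) / sinh β := by fun_prop
    fun_prop
  have h1 : (fun x : ℝ => (sinhWindow β m x : ℂ) * Complex.exp (-(Complex.I * w * x))) = (Set.Icc (-m) m).indicator g := by
    ext x
    simp only [Set.indicator, sinhWindow, Set.mem_Icc, ← abs_le]
    split_ifs <;> simp [hg]
  rw [h1, integral_indicator measurableSet_Icc, integral_Icc_eq_integral_Ioc,
    ← intervalIntegral.integral_of_le (by linarith)]
  have h2 := intervalIntegral.integral_deriv_smul_comp (a := -(π/2)) (b := π/2) (f := fun θ => m * sin θ)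
    (f' := fun θ => m * cos θ) (g := g) (fun x _ => (hasDerivAt_sin x).const_mul m) (by fun_prop) hgc
  simp only [sin_neg, sin_pi_div_two, mul_neg, mul_one] at h2
  rw [← h2, ← fold, ← intervalIntegral.integral_const_mul]
  apply intervalIntegral.integral_congr
  intro θ hθ
  rw [Set.uIcc_of_le (by linarith [pi_pos])] at hθ
  have hcos : 0 ≤ cos θ := cos_nonneg_of_mem_Icc hθ
  have hsq : √(1 - (m * sin θ) ^ 2 / m ^ 2) = cos θ := by
    rw [show 1 - (m * sin θ) ^ 2 / m ^ 2 = cos θ ^ 2 by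
      rw [cos_sq']; field_simp]
    exact sqrt_sq hcos
  simp only [Function.comp, hg, hsq, Complex.real_smul]
  push_cast
  rw [show Complex.I * w * (m * Complex.sin θ) = Complex.I * (m * w) * Complex.sin θ by ring]
  ring

lemma ft_bound (β m w : ℝ) (hm : 0 < m) (hβ : 1 ≤ β) (hw : β / m < w) :
    ‖fourierTf (fun x : ℝ => (sinhWindow β m x : ℂ)) w‖ ≤
      (80 * β * exp (-β)) * (m * (1 + (m * w - β)) ^ (-(3/2) : ℝ)) := by
  have hs : β < m * w := by rw [div_lt_iff₀ hm] at hw; linarith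
  have hP := P_bound β (m * w) (by linarith) hs
  unfold fourierTf
  rw [window_ft β m w hm, norm_mul, norm_mul, norm_mul, Complex.norm_real]
  have hsinh : 0 < sinh β := sinh_pos_iff.2 (by linarith)
  have hsb : 1 / sinh β ≤ 4 * exp (-β) := by
    rw [div_le_iff₀ hsinh, sinh_eq]
    have h1 : exp (-β) * exp β = 1 := by rw [← exp_add]; simp
    have h2 : exp (-β) ≤ 1/2 := by
      rw [exp_neg, ← one_div]
      apply one_div_le_one_div_of_le (by norm_num)
      linarith [add_one_le_exp β]
    nlinarith [exp_pos (-β)]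
  have hq : ‖(1 / (√(2 * π) : ℂ))‖ ≤ 1 := by
    rw [norm_div, Complex.norm_real, norm_one, Real.norm_of_nonneg (sqrt_nonneg _)]
    apply div_le_one_of_le₀ _ (sqrt_nonneg _)
    apply one_le_sqrt.2; linarith [pi_gt_three]
  rw [Real.norm_of_nonneg (by positivity), show ‖(1/2:ℂ)‖ = 1/2 by norm_num]
  have hX : 0 ≤ (1 + (m * w - β)) ^ (-(3/2) : ℝ) := rpow_nonneg (by linarith) _
  calc _ ≤ 1 * (m / sinh β * (1/2 * (40 * β * (1 + (m * w - β)) ^ (-(3/2) : ℝ)))) := by gcongr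
    _ = (1 / sinh β) * (20 * β * m * (1 + (m * w - β)) ^ (-(3/2) : ℝ)) := by ring
    _ ≤ (4 * exp (-β)) * (20 * β * m * (1 + (m * w - β)) ^ (-(3/2) : ℝ)) := by gcongr
    _ = _ := by ring

lemma dom (β m : ℝ) (hm : 0 < m) :
    IntegrableOn (fun w : ℝ => m * (1 + (m * w - β)) ^ (-(3/2) : ℝ)) (Set.Ioi (β / m)) ∧
    ∫ w in Set.Ioi (β / m), m * (1 + (m * w - β)) ^ (-(3/2) : ℝ) = 2 := by
  have hpos : ∀ x ∈ Set.Ici (β/m), 0 < 1 + (m * x - β) := by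
    intro x hx
    have : β / m ≤ x := hx
    rw [div_le_iff₀ hm] at this; linarith
  have hder : ∀ x ∈ Set.Ici (β/m), HasDerivAt (fun w : ℝ => -2 * (1 + (m * w - β)) ^ (-(1/2) : ℝ))
      (m * (1 + (m * x - β)) ^ (-(3/2) : ℝ)) x := by
    intro x hx
    have h1 : HasDerivAt (fun w : ℝ => 1 + (m * w - β)) m x := by
      simpa using (((hasDerivAt_id x).const_mul m).sub_const β).const_add 1
    have h2 := (h1.rpow_const (p := -(1/2)) (Or.inl (hpos x hx).ne')).const_mul (-2)
    rw [show (-(1/2) - 1 : ℝ) = -(3/2) by norm_num] at h2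
    have e : m * (1 + (m * x - β)) ^ (-(3/2) : ℝ) = -2 * (m * -(1/2) * (1 + (m * x - β)) ^ (-(3/2) : ℝ)) := by ring
    rw [e]; exact h2
  have hcont : ContinuousWithinAt (fun w : ℝ => -2 * (1 + (m * w - β)) ^ (-(1/2) : ℝ)) (Set.Ici (β/m)) (β/m) :=
    (hder _ Set.self_mem_Ici).continuousAt.continuousWithinAt
  have hlim : Filter.Tendsto (fun w : ℝ => -2 * (1 + (m * w - β)) ^ (-(1/2) : ℝ)) Filter.atTop (nhds 0) := by
    have h1 : Filter.Tendsto (fun w : ℝ => 1 + (m * w - β)) Filter.atTop Filter.atTop := by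
      apply Filter.tendsto_atTop_add_const_left
      apply Filter.tendsto_atTop_add_const_right
      exact Filter.tendsto_id.const_mul_atTop hm
    simpa using ((tendsto_rpow_neg_atTop (y := 1/2) (by norm_num)).comp h1).const_mul (-2)
  have hnn : ∀ x ∈ Set.Ioi (β/m), 0 ≤ m * (1 + (m * x - β)) ^ (-(3/2) : ℝ) := fun x hx =>
    mul_nonneg hm.le (rpow_nonneg (hpos x (Set.Ioi_subset_Ici_self hx)).le _)
  refine ⟨integrableOn_Ioi_deriv_of_nonneg hcont (fun x hx => hder x (Set.Ioi_subset_Ici_self hx)) hnn hlim, ?_⟩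
  rw [integral_Ioi_of_hasDerivAt_of_nonneg hcont (fun x hx => hder x (Set.Ioi_subset_Ici_self hx)) hnn hlim,
    mul_div_cancel₀ _ hm.ne']
  simp

lemma ft_even (β m w : ℝ) : fourierTf (fun x : ℝ => (sinhWindow β m x : ℂ)) (-w) =
    fourierTf (fun x : ℝ => (sinhWindow β m x : ℂ)) w := by
  unfold fourierTf
  congr 1
  rw [← integral_neg_eq_self]
  congr 1; ext x
  simp [sinhWindow]

theorem stmt10 :
    ∃ C : ℝ, 0 < C ∧ ∀ m : ℕ, 0 < m → ∀ β : ℝ, 1 ≤ β →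
      (∫ w in Set.Ioi (β / (m : ℝ)),
          ‖fourierTf (fun x : ℝ => (sinhWindow β (m : ℝ) x : ℂ)) w‖) ≤
        C * β * Real.exp (-β) ∧
      (∫ w in Set.Iio (-(β / (m : ℝ))),
          ‖fourierTf (fun x : ℝ => (sinhWindow β (m : ℝ) x : ℂ)) w‖) ≤
        C * β * Real.exp (-β) := by
  refine ⟨160, by norm_num, fun m hm β hβ => ?_⟩
  have hm' : (0:ℝ) < m := by exact_mod_cast hm
  have key : (∫ w in Set.Ioi (β / (m : ℝ)),
          ‖fourierTf (fun x : ℝ => (sinhWindow β (m : ℝ) x : ℂ)) w‖) ≤ 160 * β * Real.exp (-β) := by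
    obtain ⟨hi, hv⟩ := dom β m hm'
    refine (integral_mono_of_nonneg (Filter.Eventually.of_forall fun _ => norm_nonneg _)
      (hi.const_mul (80 * β * exp (-β))) ?_).trans ?_
    · filter_upwards [ae_restrict_mem measurableSet_Ioi] with w hw
      exact ft_bound β m w hm' hβ hw
    · rw [integral_const_mul, hv]; linarith
  refine ⟨key, ?_⟩
  rw [← integral_Iic_eq_integral_Iio, ← integral_comp_neg_Ioi]
  simp_rw [ft_even]
  exact key
end

section
/- Let β ≥ 1 and let J : [0, ∞) → ℝ be a measurable function satisfying |J(x)| ≤ x/4 for 0 ≤ x ≤ 1 and |J(x)| ≤ √(2/(πx)) for x ≥ 1. Then there exists an absolute constant C (independent of β and J) such that ∫_{1}^{∞} |J( β√(v²−1) )| / √(v²−1) dv ≤ C. -/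
lemma aux_int : MeasureTheory.IntegrableOn (fun v : ℝ => (v ^ 2 - 1) ^ (-(3/4) : ℝ)) (Set.Ioi 1) := by
  have hm : Measurable (fun v : ℝ => (v ^ 2 - 1) ^ (-(3/4) : ℝ)) := by fun_prop
  rw [← Set.Ioc_union_Ioi_eq_Ioi (show (1:ℝ) ≤ 2 by norm_num)]
  apply MeasureTheory.IntegrableOn.union
  · have h := (intervalIntegral.intervalIntegrable_rpow' (a := 0) (b := 1) (r := -(3/4)) (by norm_num)).comp_sub_right 1
    norm_num at h
    rw [intervalIntegrable_iff_integrableOn_Ioc_of_le (by norm_num)] at h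
    norm_num at h ⊢
    refine MeasureTheory.Integrable.mono' h (by simpa using hm.aestronglyMeasurable) ?_
    refine (MeasureTheory.ae_restrict_iff' measurableSet_Ioc).2 (Filter.Eventually.of_forall fun v hv => ?_)
    have h1 : 0 < v - 1 := by linarith [hv.1]
    rw [Real.norm_of_nonneg (Real.rpow_nonneg (by nlinarith) _)]
    exact Real.rpow_le_rpow_of_nonpos h1 (by nlinarith) (by norm_num)
  · have h := integrableOn_add_rpow_Ioi_of_lt (a := -(3/2)) (c := 2) (m := -1) (by norm_num) (by norm_num)
    refine MeasureTheory.Integrable.mono' h hm.aestronglyMeasurable ?_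
    refine (MeasureTheory.ae_restrict_iff' measurableSet_Ioi).2 (Filter.Eventually.of_forall fun v hv => ?_)
    have hv : 2 < v := hv
    rw [Real.norm_of_nonneg (Real.rpow_nonneg (by nlinarith) _)]
    have e : (v + -1) ^ (-(3/2) : ℝ) = ((v + -1)^2) ^ (-(3/4) : ℝ) := by
      rw [← Real.rpow_natCast, ← Real.rpow_mul (by linarith)]; norm_num
    rw [e]
    exact Real.rpow_le_rpow_of_nonpos (by nlinarith) (by nlinarith) (by norm_num)

lemma aux_J (J : ℝ → ℝ) (h0 : ∀ x : ℝ, 0 ≤ x → x ≤ 1 → |J x| ≤ x / 4)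
    (h1 : ∀ x : ℝ, 1 ≤ x → |J x| ≤ Real.sqrt (2 / (Real.pi * x))) (x : ℝ) (hx : 0 < x) :
    |J x| ≤ x ^ (-(1/2) : ℝ) := by
  rcases le_total x 1 with h | h
  · have := Real.one_le_rpow_of_pos_of_le_one_of_nonpos hx h (show (-(1/2) : ℝ) ≤ 0 by norm_num)
    linarith [h0 x hx.le h]
  · refine (h1 x h).trans ?_
    rw [Real.rpow_neg hx.le, ← Real.sqrt_eq_rpow, ← Real.sqrt_inv]
    apply Real.sqrt_le_sqrt
    have := Real.pi_gt_three
    rw [inv_eq_one_div, div_le_div_iff₀ (by positivity) hx]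
    nlinarith

/-- Bessel-type integral estimate: there is an absolute constant `C` such that for
every `β ≥ 1` and every measurable `J` with `|J(x)| ≤ x/4` on `[0,1]` and
`|J(x)| ≤ √(2/(πx))` on `[1,∞)`, one has
`∫_1^∞ |J(β√(v²-1))| / √(v²-1) dv ≤ C`. -/
theorem stmt11 :
    ∃ C : ℝ, ∀ β : ℝ, 1 ≤ β → ∀ J : ℝ → ℝ, Measurable J →
      (∀ x : ℝ, 0 ≤ x → x ≤ 1 → |J x| ≤ x / 4) →
      (∀ x : ℝ, 1 ≤ x → |J x| ≤ Real.sqrt (2 / (Real.pi * x))) →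
      (∫ v in Set.Ioi (1 : ℝ),
        |J (β * Real.sqrt (v ^ 2 - 1))| / Real.sqrt (v ^ 2 - 1)) ≤ C := by
  refine ⟨∫ v in Set.Ioi (1 : ℝ), (v ^ 2 - 1) ^ (-(3/4) : ℝ), fun β hβ J _ h0 h1 => ?_⟩
  refine MeasureTheory.integral_mono_of_nonneg (Filter.Eventually.of_forall fun v => by positivity) aux_int ?_
  refine (MeasureTheory.ae_restrict_iff' measurableSet_Ioi).2 (Filter.Eventually.of_forall fun v hv => ?_)
  have hv : 1 < v := hv
  have hp : 0 < v ^ 2 - 1 := by nlinarith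
  have hy : 0 < Real.sqrt (v ^ 2 - 1) := Real.sqrt_pos.2 hp
  have hJ := aux_J J h0 h1 (β * Real.sqrt (v ^ 2 - 1)) (by positivity)
  have hJ2 : (β * Real.sqrt (v ^ 2 - 1)) ^ (-(1/2) : ℝ) ≤ (Real.sqrt (v ^ 2 - 1)) ^ (-(1/2) : ℝ) :=
    Real.rpow_le_rpow_of_nonpos hy (by nlinarith) (by norm_num)
  show _ / _ ≤ _
  rw [div_le_iff₀ hy]
  refine (hJ.trans hJ2).trans (le_of_eq ?_)
  rw [Real.sqrt_eq_rpow, ← Real.rpow_mul hp.le, ← Real.rpow_add hp]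
  norm_num
end
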